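/- There exists a magic knight's tour of the 4×28 board: a knight's tour in which each of the four 28-cell rows sums to 1582 and each of the twenty-eight 4-cell columns sums to 226. -/

import Mathlib

/-- Two cells are a knight's move apart: coordinate differences in absolute
value are {1,2}. -/
def knightMove {m n : ℕ} (a b : Fin m × Fin n) : Prop :=
  (((a.1.val : ℤ) - b.1.val).natAbs = 1 ∧ ((a.2.val : ℤ) - b.2.val).natAbs = 2) ∨
  (((a.1.val : ℤ) - b.1.val).natAbs = 2 ∧ ((a.2.val : ℤ) - b.2.val).natAbs = 1)

/-- A knight's tour of the m×n board: a bijective numbering (as an equiv from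
`Fin (m*n)`, representing the numbers 1,…,m·n) of the cells, such that
consecutive numbers occupy cells a knight's move apart. -/
def IsKnightTour (m n : ℕ) (t : Fin (m * n) ≃ Fin m × Fin n) : Prop :=
  ∀ (k : ℕ) (h : k + 1 < m * n),
    knightMove (t ⟨k, Nat.lt_of_succ_lt h⟩) (t ⟨k + 1, h⟩)

/-- The number (in 1,…,m·n) assigned to a cell by the tour. -/
def cellNum {m n : ℕ} (t : Fin (m * n) ≃ Fin m × Fin n) (c : Fin m × Fin n) : ℕ :=
  (t.symm c).val + 1

/-- The sum of the numbers in row `i` (an n-cell line). -/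
def rowSum {m n : ℕ} (t : Fin (m * n) ≃ Fin m × Fin n) (i : Fin m) : ℕ :=
  ∑ j : Fin n, cellNum t (i, j)

/-- The sum of the numbers in column `j` (an m-cell line). -/
def colSum {m n : ℕ} (t : Fin (m * n) ≃ Fin m × Fin n) (j : Fin n) : ℕ :=
  ∑ i : Fin m, cellNum t (i, j)

/-- The cells of a magic knight's tour of the 4×28 board, in the order in which they are visited. -/
def magicTourCell : Fin (4 * 28) → Fin 4 × Fin 28 :=
  ![(0, 2), (1, 0), (3, 1), (2, 3), (0, 4), (2, 5), (0, 6), (2, 7),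
    (3, 9), (1, 8), (0, 10), (2, 11), (3, 13), (1, 14), (3, 15), (1, 16),
    (3, 17), (1, 18), (3, 19), (1, 20), (0, 22), (2, 21), (0, 20), (1, 22),
    (3, 23), (1, 24), (0, 26), (2, 27), (3, 25), (1, 26), (3, 27), (2, 25),
    (0, 24), (2, 23), (3, 21), (2, 19), (0, 18), (2, 17), (0, 16), (2, 15),
    (0, 14), (1, 12), (3, 11), (2, 13), (0, 12), (1, 10), (0, 8), (2, 9),
    (3, 7), (1, 6), (3, 5), (1, 4), (3, 3), (2, 1), (0, 0), (1, 2),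
    (2, 0), (3, 2), (1, 1), (0, 3), (2, 4), (0, 5), (2, 6), (0, 7),
    (1, 9), (3, 8), (2, 10), (3, 12), (1, 13), (0, 11), (2, 12), (3, 14),
    (1, 15), (3, 16), (1, 17), (3, 18), (1, 19), (0, 21), (1, 23), (3, 24),
    (1, 25), (0, 27), (2, 26), (0, 25), (1, 27), (3, 26), (2, 24), (0, 23),
    (2, 22), (3, 20), (1, 21), (3, 22), (2, 20), (0, 19), (2, 18), (0, 17),
    (2, 16), (0, 15), (2, 14), (0, 13), (1, 11), (3, 10), (2, 8), (0, 9),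
    (1, 7), (3, 6), (1, 5), (3, 4), (1, 3), (0, 1), (2, 2), (3, 0)]

/-- The board of the same tour: entry `(i, j)` is the number assigned to the cell `(i, j)`. -/
def magicTourBoard : Fin 4 → Fin 28 → ℕ :=
  ![![55, 110, 1, 60, 5, 62, 7, 64, 47, 104, 11, 70, 45, 100,
      41, 98, 39, 96, 37, 94, 23, 78, 21, 88, 33, 84, 27, 82],
    ![2, 59, 56, 109, 52, 107, 50, 105, 10, 65, 46, 101, 42, 69,
      14, 73, 16, 75, 18, 77, 20, 91, 24, 79, 26, 81, 30, 85],
    ![57, 54, 111, 4, 61, 6, 63, 8, 103, 48, 67, 12, 71, 44,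
      99, 40, 97, 38, 95, 36, 93, 22, 89, 34, 87, 32, 83, 28],
    ![112, 3, 58, 53, 108, 51, 106, 49, 66, 9, 102, 43, 68, 13,
      72, 15, 74, 17, 76, 19, 90, 35, 92, 25, 80, 29, 86, 31]]

/-- The tour that visits `magicTourCell 0`, `magicTourCell 1`, … in turn. -/
def magicTour : Fin (4 * 28) ≃ Fin 4 × Fin 28 where
  toFun := magicTourCell
  invFun c := Fin.ofNat (4 * 28) (magicTourBoard c.1 c.2 - 1)
  left_inv := by unfold Function.LeftInverse; decide +kernel
  right_inv := by unfold Function.RightInverse Function.LeftInverse; decide +kernel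

instance {m n : ℕ} (a b : Fin m × Fin n) : Decidable (knightMove a b) := by
  unfold knightMove; infer_instance

theorem magicTour_isKnightTour : IsKnightTour 4 28 magicTour := by
  unfold IsKnightTour
  have key : ∀ k : Fin 111, knightMove (magicTour k.castSucc) (magicTour k.succ) := by
    decide +kernel
  exact fun k h => key ⟨k, by omega⟩

theorem rowSum_magicTour : ∀ i : Fin 4, rowSum magicTour i = 1582 := by
  decide +kernel

theorem colSum_magicTour : ∀ j : Fin 28, colSum magicTour j = 226 := by
  decide +kernel

/-- There exists a magic knight's tour of the 4×28 board. -/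
theorem magic_tour_4x28 :
    ∃ t : Fin (4 * 28) ≃ Fin 4 × Fin 28, IsKnightTour 4 28 t ∧
      (∀ i : Fin 4, rowSum t i = 1582) ∧ (∀ j : Fin 28, colSum t j = 226) := by
  exact ⟨magicTour, magicTour_isKnightTour, rowSum_magicTour, colSum_magicTour⟩
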